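/- Let A = k[x,y]/(x², y², xy) over a field k and A* = Hom_k(A, k) its dual with the induced A-A-bimodule structure. Then dim_k Hom_{A-A}(A, A ⊗_k A*) = 3. -/

import Mathlib

set_option synthInstance.maxHeartbeats 1000000
set_option maxHeartbeats 1000000

open scoped TensorProduct

/-- The algebra `A = k[x,y]/(x², y², xy)`. -/
noncomputable abbrev TheAlgebraA (k : Type) [Field k] : Type :=
  MvPolynomial (Fin 2) k ⧸
    Ideal.span ({MvPolynomial.X 0 ^ 2, MvPolynomial.X 1 ^ 2,
      MvPolynomial.X 0 * MvPolynomial.X 1} : Set (MvPolynomial (Fin 2) k))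

/-- The centralizer condition on an element `z` of the `A`-`A`-bimodule `A ⊗ₖ A*`
(where `A* = Hom_k(A,k)` has bimodule structure `(a·f·b)(c) = f (b*c*a)` and `A ⊗ₖ A*`
carries the outer actions): `a · z = z · a` for all `a : A`.  Elements satisfying it
correspond exactly to bimodule homomorphisms `A → A ⊗ₖ A*` (as images of `1`). -/
def isCentral10 (k : Type) [Field k]
    (z : TheAlgebraA k ⊗[k] Module.Dual k (TheAlgebraA k)) : Prop :=
  ∀ a : TheAlgebraA k,
    LinearMap.rTensor (Module.Dual k (TheAlgebraA k)) (LinearMap.mulLeft k a) z =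
      LinearMap.lTensor (TheAlgebraA k) (LinearMap.lcomp k k (LinearMap.mulLeft k a)) z

namespace Stmt10Aux

variable (k : Type) [Field k]

noncomputable def x (i : Fin 2) : TheAlgebraA k := Ideal.Quotient.mk _ (MvPolynomial.X i)

lemma x_mul (i j : Fin 2) : x k i * x k j = 0 := by
  unfold x
  rw [← map_mul, Ideal.Quotient.eq_zero_iff_mem]
  fin_cases i <;> fin_cases j
  · exact Ideal.subset_span (by simp [pow_two])
  · exact Ideal.subset_span (by simp [pow_two])
  · exact Ideal.subset_span (by simp [pow_two, mul_comm])
  · exact Ideal.subset_span (by simp [pow_two])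

noncomputable def phi0 : MvPolynomial (Fin 2) k →ₐ[k] TrivSqZeroExt k (Fin 2 → k) :=
  MvPolynomial.aeval (fun i => TrivSqZeroExt.inr (Pi.single i 1))

noncomputable def phi : TheAlgebraA k →ₐ[k] TrivSqZeroExt k (Fin 2 → k) :=
  Ideal.Quotient.liftₐ _ (phi0 k) (by
    intro a ha
    have h : Ideal.span ({MvPolynomial.X 0 ^ 2, MvPolynomial.X 1 ^ 2,
      MvPolynomial.X 0 * MvPolynomial.X 1} : Set (MvPolynomial (Fin 2) k))
        ≤ RingHom.ker (phi0 k) := by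
      rw [Ideal.span_le]
      rintro p (rfl | rfl | rfl) <;> simp [phi0, RingHom.mem_ker, pow_two]
    exact h ha)

lemma phi_x (i : Fin 2) : phi k (x k i) = TrivSqZeroExt.inr (Pi.single i 1) := by
  have : phi k (x k i) = phi0 k (MvPolynomial.X i) := rfl
  rw [this]; simp [phi0]

noncomputable def b : Fin 3 → TheAlgebraA k := ![1, x k 0, x k 1]

lemma b_indep : LinearIndependent k (b k) := by
  rw [Fintype.linearIndependent_iff]
  intro g hg
  have h := congrArg (phi k) hg
  simp only [b, Fin.sum_univ_three, map_add, map_smul, Matrix.cons_val_zero,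
    Matrix.cons_val_one, Matrix.cons_val, phi_x, map_one, map_zero] at h
  have h0 := congrArg TrivSqZeroExt.fst h
  have h1 := congrFun (congrArg TrivSqZeroExt.snd h) 0
  have h2 := congrFun (congrArg TrivSqZeroExt.snd h) 1
  simp at h0 h1 h2
  intro i
  fin_cases i <;> simp [h0, h1, h2]

lemma b_span (a : TheAlgebraA k) : ∃ c d e : k, a = c • 1 + d • x k 0 + e • x k 1 := by
  obtain ⟨p, rfl⟩ := Ideal.Quotient.mk_surjective a
  induction p using MvPolynomial.induction_on with
  | C r =>
    refine ⟨r, 0, 0, ?_⟩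
    simp only [zero_smul, add_zero]
    rw [← Algebra.algebraMap_eq_smul_one]; rfl
  | add p q hp hq =>
    obtain ⟨c, d, e, h⟩ := hp
    obtain ⟨c2, d2, e2, h2⟩ := hq
    refine ⟨c + c2, d + d2, e + e2, ?_⟩
    rw [map_add, h, h2]; simp only [add_smul]; abel
  | mul_X p i hp =>
    obtain ⟨c, d, e, h⟩ := hp
    have : (Ideal.Quotient.mk _ (p * MvPolynomial.X i) : TheAlgebraA k) = c • x k i := by
      rw [map_mul, h]
      change _ * x k i = _
      simp only [add_mul, smul_mul_assoc, one_mul, x_mul, smul_zero, add_zero]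
    rw [this]
    fin_cases i
    · exact ⟨0, c, 0, by simp⟩
    · exact ⟨0, 0, c, by simp⟩

lemma b_top (a : TheAlgebraA k) : a ∈ Submodule.span k (Set.range (b k)) := by
  obtain ⟨c, d, e, rfl⟩ := b_span k a
  refine add_mem (add_mem ?_ ?_) ?_ <;> refine Submodule.smul_mem _ _ (Submodule.subset_span ?_)
  exacts [⟨0, rfl⟩, ⟨1, rfl⟩, ⟨2, rfl⟩]

noncomputable def bas : Module.Basis (Fin 3) k (TheAlgebraA k) :=
  Module.Basis.mk (b_indep k) (fun a _ => b_top k a)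

lemma fin : Module.Finite k (TheAlgebraA k) := Module.Finite.of_basis (bas k)

noncomputable def E : TheAlgebraA k ⊗[k] Module.Dual k (TheAlgebraA k) ≃ₗ[k]
    (TheAlgebraA k →ₗ[k] TheAlgebraA k) :=
  haveI := fin k
  (TensorProduct.comm k _ _).trans (dualTensorHomEquiv k (TheAlgebraA k) (TheAlgebraA k))

lemma E_tmul (u : TheAlgebraA k) (f : Module.Dual k (TheAlgebraA k)) (c : TheAlgebraA k) :
    E k (u ⊗ₜ f) c = f c • u := by
  simp [E]

lemma E_left (a : TheAlgebraA k) (z) (c : TheAlgebraA k) :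
    E k (LinearMap.rTensor (Module.Dual k (TheAlgebraA k)) (LinearMap.mulLeft k a) z) c
      = a * E k z c := by
  induction z using TensorProduct.induction_on with
  | zero => simp only [map_zero, LinearMap.zero_apply, mul_zero]
  | tmul u f => rw [LinearMap.rTensor_tmul, E_tmul, E_tmul, LinearMap.mulLeft_apply, mul_smul_comm]
  | add z w hz hw => simp only [map_add, LinearMap.add_apply, mul_add, hz, hw]

lemma E_right (a : TheAlgebraA k) (z) (c : TheAlgebraA k) :
    E k (LinearMap.lTensor (TheAlgebraA k) (LinearMap.lcomp k k (LinearMap.mulLeft k a)) z) c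
      = E k z (a * c) := by
  induction z using TensorProduct.induction_on with
  | zero => simp only [map_zero, LinearMap.zero_apply]
  | tmul u f => rw [LinearMap.lTensor_tmul, E_tmul, E_tmul]; rfl
  | add z w hz hw => simp only [map_add, LinearMap.add_apply, hz, hw]

lemma central_iff (z) : isCentral10 k z ↔ ∀ a c, a * E k z c = E k z (a * c) := by
  unfold isCentral10
  refine forall_congr' fun a => ?_
  rw [← (E k).injective.eq_iff, LinearMap.ext_iff]
  refine forall_congr' fun c => ?_
  rw [E_left, E_right]

noncomputable def F : TheAlgebraA k →ₗ[k] TheAlgebraA k ⊗[k] Module.Dual k (TheAlgebraA k) :=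
  (E k).symm.toLinearMap ∘ₗ LinearMap.mul k (TheAlgebraA k)

lemma E_F (a c : TheAlgebraA k) : E k (F k a) c = a * c := by
  simp [F]

end Stmt10Aux

/-- For `A = k[x,y]/(x²,y²,xy)` one has `dim_k Hom_{A-A}(A, A ⊗ₖ A*) = 3`: there are three
linearly independent centralized elements of `A ⊗ₖ A*` which span the space of all
centralized elements. -/
theorem stmt_10 (k : Type) [Field k] :
    ∃ v : Fin 3 → TheAlgebraA k ⊗[k] Module.Dual k (TheAlgebraA k),
      LinearIndependent k v ∧ (∀ i, isCentral10 k (v i)) ∧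
        ∀ z, isCentral10 k z → z ∈ Submodule.span k (Set.range v) := by
  open Stmt10Aux in
  refine ⟨fun i => F k (b k i), ?_, ?_, ?_⟩
  · refine (b_indep k).map' (F k) (LinearMap.ker_eq_bot.2 fun a a2 h => ?_)
    have := congrArg (fun z => E k z 1) h
    simpa only [E_F, mul_one] using this
  · intro i
    rw [central_iff]
    intro a c
    rw [E_F, E_F, mul_left_comm]
  · intro z hz
    rw [central_iff] at hz
    have hzF : z = F k (E k z 1) := by
      apply (E k).injective
      refine LinearMap.ext fun c => ?_
      rw [E_F, mul_comm (E k z 1) c, hz, mul_one]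
    rw [hzF]
    have := Submodule.mem_map_of_mem (f := F k) (b_top k (E k z 1))
    rw [Submodule.map_span, ← Set.range_comp] at this
    exact this
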